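/- Let R = ℤ, S = ℤ ∖ 3ℤ, and I = 6ℤ. Then I is an S-irreducible ideal of ℤ (indeed with witness s = 2: s·3ℤ ⊆ I) but I is not an irreducible ideal, since I = 2ℤ ∩ 3ℤ with I ≠ 2ℤ and I ≠ 3ℤ. -/

import Mathlib

/-- An ideal `Q` disjoint from `S` is `S`-irreducible if whenever
`s(I ∩ J) ⊆ Q ⊆ I ∩ J` for some `s ∈ S` and ideals `I`, `J`, there is `s' ∈ S`
such that `s s' I ⊆ Q` or `s s' J ⊆ Q`. -/
def IsSIrreducible {R : Type*} [CommRing R] (S : Submonoid R) (Q : Ideal R) : Prop :=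
  Disjoint (S : Set R) (Q : Set R) ∧
    ∀ s ∈ S, ∀ I J : Ideal R, (∀ x ∈ I ⊓ J, s * x ∈ Q) → Q ≤ I ⊓ J →
      ∃ s' ∈ S, (∀ x ∈ I, s * s' * x ∈ Q) ∨ (∀ x ∈ J, s * s' * x ∈ Q)

/-- The multiplicative set `ℤ ∖ 3ℤ`. -/
def S3 : Submonoid ℤ where
  carrier := {x : ℤ | x ∉ Ideal.span ({3} : Set ℤ)}
  one_mem' := by
    simp only [Set.mem_setOf_eq, Ideal.mem_span_singleton]
    decide
  mul_mem' := by
    intro a b ha hb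
    simp only [Set.mem_setOf_eq, Ideal.mem_span_singleton] at *
    intro hab
    rcases (Int.prime_three.2.2 a b hab) with h | h
    · exact ha h
    · exact hb h

/-- In `ℤ` with `S = ℤ ∖ 3ℤ`, the ideal `6ℤ` is `S`-irreducible, but it is not an
irreducible ideal since `6ℤ = 2ℤ ∩ 3ℤ` with `6ℤ ≠ 2ℤ` and `6ℤ ≠ 3ℤ`. -/
theorem sixZ_SIrreducible_not_irreducible :
    IsSIrreducible S3 (Ideal.span ({6} : Set ℤ)) ∧
      Ideal.span ({6} : Set ℤ) = Ideal.span ({2} : Set ℤ) ⊓ Ideal.span ({3} : Set ℤ) ∧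
      Ideal.span ({6} : Set ℤ) ≠ Ideal.span ({2} : Set ℤ) ∧
      Ideal.span ({6} : Set ℤ) ≠ Ideal.span ({3} : Set ℤ) := by
  simp only [ne_eq, Ideal.span_singleton_eq_span_singleton, Int.associated_iff]
  refine ⟨⟨?_, ?_⟩, ?_, by decide, by decide⟩
  · rw [Set.disjoint_left]
    intro x hx h6
    refine hx (Ideal.mem_span_singleton.2 ?_)
    exact (by norm_num : (3 : ℤ) ∣ 6).trans (Ideal.mem_span_singleton.1 h6)
  · intro s hs I J hIJ _
    have two_mem : (2 : ℤ) ∈ S3 := fun h => by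
      have := Ideal.mem_span_singleton.1 h
      omega
    have two_mul_mem (x : ℤ) (hx : x ∈ Ideal.span ({3} : Set ℤ)) :
        s * 2 * x ∈ Ideal.span ({6} : Set ℤ) := by
      rw [Ideal.mem_span_singleton] at hx ⊢
      obtain ⟨k, rfl⟩ := hx
      exact ⟨s * k, by ring⟩
    by_cases hI : I ≤ Ideal.span ({3} : Set ℤ)
    · exact ⟨2, two_mem, Or.inl fun x hx => two_mul_mem x (hI hx)⟩
    by_cases hJ : J ≤ Ideal.span ({3} : Set ℤ)
    · exact ⟨2, two_mem, Or.inr fun x hx => two_mul_mem x (hJ hx)⟩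
    obtain ⟨a, haI, ha⟩ := SetLike.not_le_iff_exists.1 hI
    obtain ⟨b, hbJ, hb⟩ := SetLike.not_le_iff_exists.1 hJ
    have h6 := hIJ (a * b) ⟨I.mul_mem_right b haI, J.mul_mem_left a hbJ⟩
    have hsab : s * (a * b) ∈ S3 := S3.mul_mem hs (S3.mul_mem ha hb)
    refine absurd (Ideal.mem_span_singleton.2 ?_) hsab
    exact (by norm_num : (3 : ℤ) ∣ 6).trans (Ideal.mem_span_singleton.1 h6)
  · ext x
    simp only [Ideal.mem_inf, Ideal.mem_span_singleton]
    omega
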